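/- arXiv:2111.08200 — 2 statements merged into one kernel-verified Lean document; each statement's English description precedes it below -/
import Mathlib

section
/- Let g be a C² function on [0,1] with g(0) = g(1) = 0 and L g = g'' + g'/r − g/r². Then ∫₀¹ |(d/dr)(r g)|² (1/r) dr ≤ ∫₀¹ |L g|² r dr. -/
open MeasureTheory Set

lemma aux_pt (r a c e : ℝ) (h0 : 0 < r) (h1 : r < 1) :
    (a + r * c) ^ 2 / r + (-4 * (a * c) - 2 * r * (c ^ 2 + a * e))
      ≤ (e + c / r - a / r ^ 2) ^ 2 * r := by
  have key : (e + c / r - a / r ^ 2) ^ 2 * r -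
      ((a + r * c) ^ 2 / r + (-4 * (a * c) - 2 * r * (c ^ 2 + a * e)))
      = r * (e + c / r - a / r ^ 2 + a) ^ 2 + a ^ 2 * (1 - r ^ 2) / r + r * c ^ 2 := by
    field_simp
    ring
  have h2 : 0 ≤ 1 - r ^ 2 := by nlinarith
  have : 0 ≤ r * (e + c / r - a / r ^ 2 + a) ^ 2 + a ^ 2 * (1 - r ^ 2) / r + r * c ^ 2 := by
    positivity
  linarith

lemma aux_lint (A B f : ℝ → ℝ) (hf : IntegrableOn f (Ioo (0:ℝ) 1))
    (hi : ∫ r in Ioo (0:ℝ) 1, f r = 0)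
    (h : ∀ r ∈ Ioo (0:ℝ) 1, 0 ≤ A r ∧ 0 ≤ B r ∧ A r + f r ≤ B r) :
    ∫⁻ r in Ioo (0:ℝ) 1, ENNReal.ofReal (A r) ≤ ∫⁻ r in Ioo (0:ℝ) 1, ENNReal.ofReal (B r) := by
  have hp : ∫⁻ r in Ioo (0:ℝ) 1, ENNReal.ofReal (f r) ≠ ⊤ := hf.lintegral_lt_top.ne
  have hn : ∫⁻ r in Ioo (0:ℝ) 1, ENNReal.ofReal (-f r) ≠ ⊤ := hf.neg.lintegral_lt_top.ne
  have he : ∫⁻ r in Ioo (0:ℝ) 1, ENNReal.ofReal (f r)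
      = ∫⁻ r in Ioo (0:ℝ) 1, ENNReal.ofReal (-f r) := by
    rw [integral_eq_lintegral_pos_part_sub_lintegral_neg_part hf, sub_eq_zero] at hi
    exact (ENNReal.toReal_eq_toReal_iff' hp hn).1 hi
  have hm := hf.aestronglyMeasurable.aemeasurable
  have := calc
    (∫⁻ r in Ioo (0:ℝ) 1, ENNReal.ofReal (A r)) + ∫⁻ r in Ioo (0:ℝ) 1, ENNReal.ofReal (f r)
      = ∫⁻ r in Ioo (0:ℝ) 1, (ENNReal.ofReal (A r) + ENNReal.ofReal (f r)) :=
        (lintegral_add_right' _ hm.ennreal_ofReal).symm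
    _ ≤ ∫⁻ r in Ioo (0:ℝ) 1, (ENNReal.ofReal (B r) + ENNReal.ofReal (-f r)) := by
        refine setLIntegral_mono' measurableSet_Ioo fun r hr => ?_
        obtain ⟨hA, hB, hAB⟩ := h r hr
        rcases le_total 0 (f r) with h' | h'
        · rw [← ENNReal.ofReal_add hA h', ENNReal.ofReal_of_nonpos (p := -f r) (by linarith),
            add_zero]
          exact ENNReal.ofReal_le_ofReal hAB
        · rw [ENNReal.ofReal_of_nonpos h', add_zero, ← ENNReal.ofReal_add hB (by linarith)]
          exact ENNReal.ofReal_le_ofReal (by linarith)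
    _ = (∫⁻ r in Ioo (0:ℝ) 1, ENNReal.ofReal (B r))
        + ∫⁻ r in Ioo (0:ℝ) 1, ENNReal.ofReal (-f r) :=
        lintegral_add_right' _ hm.neg.ennreal_ofReal
  rw [he] at this
  exact (ENNReal.add_le_add_iff_right hn).1 this

/-- For a C² function `g` on `[0,1]` with `g(0) = g(1) = 0` and
`L g = g'' + g'/r − g/r²`, one has `∫₀¹ |(rg)'|²/r dr ≤ ∫₀¹ |Lg|² r dr`. -/
theorem stmt2 (g : ℝ → ℂ) (hg : ContDiffOn ℝ 2 g (Icc (0:ℝ) 1))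
    (h0 : g 0 = 0) (h1 : g 1 = 0) :
    (∫⁻ r in Ioo (0:ℝ) 1,
        ENNReal.ofReal (‖derivWithin (fun s : ℝ => (s : ℂ) * g s) (Icc (0:ℝ) 1) r‖ ^ 2 / r)) ≤
      ∫⁻ r in Ioo (0:ℝ) 1,
        ENNReal.ofReal
          (‖derivWithin (derivWithin g (Icc (0:ℝ) 1)) (Icc (0:ℝ) 1) r
              + derivWithin g (Icc (0:ℝ) 1) r / (r : ℂ) - g r / (r : ℂ) ^ 2‖ ^ 2 * r) := by
  have hu : UniqueDiffOn ℝ (Icc (0:ℝ) 1) := uniqueDiffOn_Icc one_pos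
  have hD : ContDiffOn ℝ 1 (derivWithin g (Icc (0:ℝ) 1)) (Icc 0 1) :=
    hg.derivWithin hu (by norm_num)
  have hE : ContinuousOn (derivWithin (derivWithin g (Icc (0:ℝ) 1)) (Icc 0 1)) (Icc 0 1) :=
    hD.continuousOn_derivWithin hu le_rfl
  have hgd : ∀ r ∈ Icc (0:ℝ) 1, HasDerivWithinAt g (derivWithin g (Icc (0:ℝ) 1) r) (Icc 0 1) r :=
    fun r hr => (hg.differentiableOn (by norm_num) r hr).hasDerivWithinAt
  have hDd : ∀ r ∈ Icc (0:ℝ) 1, HasDerivWithinAt (derivWithin g (Icc (0:ℝ) 1))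
      (derivWithin (derivWithin g (Icc (0:ℝ) 1)) (Icc 0 1) r) (Icc 0 1) r :=
    fun r hr => (hD.differentiableOn (by norm_num) r hr).hasDerivWithinAt
  have hgc := hg.continuousOn
  have hDc := hD.continuousOn
  have hw : ∀ r ∈ Icc (0:ℝ) 1, derivWithin (fun s : ℝ => (s : ℂ) * g s) (Icc (0:ℝ) 1) r
      = g r + r * derivWithin g (Icc (0:ℝ) 1) r := by
    intro r hr
    have h := ((Complex.ofRealCLM.hasDerivAt (x := r)).hasDerivWithinAt (s := Icc 0 1)).mul
      (hgd r hr)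
    have h' := h.derivWithin (hu r hr)
    refine Eq.trans ?_ (h'.trans (by simp))
    rfl
  generalize derivWithin (derivWithin g (Icc (0:ℝ) 1)) (Icc 0 1) = E at *
  generalize derivWithin g (Icc (0:ℝ) 1) = D at *
  clear hD
  have hre : ∀ {f : ℝ → ℂ} {f' : ℂ} {r : ℝ}, HasDerivAt f f' r →
      HasDerivAt (fun s => (f s).re) f'.re r := fun h =>
    Complex.reCLM.hasFDerivAt.comp_hasDerivAt _ h
  have him : ∀ {f : ℝ → ℂ} {f' : ℂ} {r : ℝ}, HasDerivAt f f' r →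
      HasDerivAt (fun s => (f s).im) f'.im r := fun h =>
    Complex.imCLM.hasFDerivAt.comp_hasDerivAt _ h
  have c1 : ContinuousOn (fun r => (g r).re) (Icc 0 1) := Complex.continuous_re.comp_continuousOn hgc
  have c2 : ContinuousOn (fun r => (g r).im) (Icc 0 1) := Complex.continuous_im.comp_continuousOn hgc
  have c3 : ContinuousOn (fun r => (D r).re) (Icc 0 1) := Complex.continuous_re.comp_continuousOn hDc
  have c4 : ContinuousOn (fun r => (D r).im) (Icc 0 1) := Complex.continuous_im.comp_continuousOn hDc
  have c5 : ContinuousOn (fun r => (E r).re) (Icc 0 1) := Complex.continuous_re.comp_continuousOn hE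
  have c6 : ContinuousOn (fun r => (E r).im) (Icc 0 1) := Complex.continuous_im.comp_continuousOn hE
  let f : ℝ → ℝ := fun r =>
    (-4 * ((g r).re * (D r).re) - 2 * r * ((D r).re ^ 2 + (g r).re * (E r).re)) +
    (-4 * ((g r).im * (D r).im) - 2 * r * ((D r).im ^ 2 + (g r).im * (E r).im))
  let F : ℝ → ℝ := fun r =>
    -((g r).re ^ 2 + (g r).im ^ 2) - 2 * r * ((g r).re * (D r).re + (g r).im * (D r).im)
  have hfc : ContinuousOn f (Icc 0 1) := by fun_prop
  have hFc : ContinuousOn F (Icc 0 1) := by fun_prop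
  have hfi : IntegrableOn f (Icc 0 1) := hfc.integrableOn_Icc
  have hF : ∀ r ∈ Ioo (0:ℝ) 1, HasDerivAt F (f r) r := by
    intro r hr
    have hn := Icc_mem_nhds hr.1 hr.2
    have hg' := (hgd r (Ioo_subset_Icc_self hr)).hasDerivAt hn
    have hD' := (hDd r (Ioo_subset_Icc_self hr)).hasDerivAt hn
    have := (((hre hg').pow 2).add ((him hg').pow 2)).neg.sub
      (((hasDerivAt_id r).const_mul 2).mul
        (((hre hg').mul (hre hD')).add ((him hg').mul (him hD'))))
    refine this.congr_deriv ?_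
    simp [f]
    ring
  have hint : ∫ r in Ioo (0:ℝ) 1, f r = 0 := by
    have := intervalIntegral.integral_eq_sub_of_hasDerivAt_of_le zero_le_one hFc hF
      ((intervalIntegrable_iff_integrableOn_Icc_of_le zero_le_one).2 hfi)
    rw [intervalIntegral.integral_of_le zero_le_one, integral_Ioc_eq_integral_Ioo] at this
    rw [this]
    simp [F, h0, h1]
  refine aux_lint _ _ f (hfi.mono_set Ioo_subset_Icc_self) hint fun r hr => ?_
  have hr0 := hr.1
  refine ⟨by positivity, by positivity, ?_⟩
  rw [hw r (Ioo_subset_Icc_self hr)]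
  have e1 := aux_pt r (g r).re (D r).re (E r).re hr.1 hr.2
  have e2 := aux_pt r (g r).im (D r).im (E r).im hr.1 hr.2
  have n1 : ‖g r + r * D r‖ ^ 2 = ((g r).re + r * (D r).re) ^ 2 + ((g r).im + r * (D r).im) ^ 2 := by
    rw [← Complex.normSq_eq_norm_sq, Complex.normSq_apply]
    simp
    ring
  have n2 : ‖E r + D r / (r : ℂ) - g r / (r : ℂ) ^ 2‖ ^ 2
      = ((E r).re + (D r).re / r - (g r).re / r ^ 2) ^ 2
        + ((E r).im + (D r).im / r - (g r).im / r ^ 2) ^ 2 := by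
    rw [← Complex.normSq_eq_norm_sq, Complex.normSq_apply, ← Complex.ofReal_pow]
    simp only [Complex.sub_re, Complex.add_re, Complex.sub_im, Complex.add_im,
      Complex.div_ofReal_re, Complex.div_ofReal_im]
    ring
  rw [n1, n2, add_div, add_mul]
  simp only [f]
  linarith
end

section
/- There exists a constant C > 0 such that for every C² function g on [0,1], ∫₀¹ |(rg)'|² (1/r) dr ≤ C (∫₀¹ ((1−r²)/r)|(rg)'|² dr)^{2/3} (∫₀¹ |Lg|² r dr)^{1/3} + C ∫₀¹ ((1−r²)/r)|(rg)'|² dr, where L g = g'' + g'/r − g/r². -/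
open MeasureTheory Set

lemma aux_cs (v : ℝ → ℂ) (s r : ℝ) (hsr : s ≤ r) (hv : ContinuousOn v (Icc s r)) :
    ‖∫ t in s..r, v t‖ ^ 2 ≤ (r - s) * ∫ t in s..r, ‖v t‖ ^ 2 := by
  rcases hsr.eq_or_lt with rfl | hlt
  · simp
  have hd : 0 < r - s := sub_pos.2 hlt
  have h1 := intervalIntegral.norm_integral_le_integral_norm (f := v) (μ := volume) hsr
  set m := ∫ t in s..r, ‖v t‖ with hm
  have hcn : ContinuousOn (fun t => ‖v t‖) (uIcc s r) := by
    rw [uIcc_of_le hsr]; exact hv.norm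
  have i1 : IntervalIntegrable (fun t => ‖v t‖) volume s r := hcn.intervalIntegrable
  have i2 : IntervalIntegrable (fun t => ‖v t‖ ^ 2) volume s r := (hcn.pow 2).intervalIntegrable
  set c := m / (r - s) with hc
  have h2 : 0 ≤ ∫ t in s..r, (‖v t‖ ^ 2 - 2 * c * ‖v t‖ + c ^ 2) := by
    apply intervalIntegral.integral_nonneg hsr
    intro t _
    nlinarith [sq_nonneg (‖v t‖ - c)]
  rw [intervalIntegral.integral_add (i2.sub (i1.const_mul _)) (by simp),
    intervalIntegral.integral_sub i2 (i1.const_mul _), intervalIntegral.integral_const_mul,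
    intervalIntegral.integral_const, ← hm, smul_eq_mul] at h2
  have hmc : m = c * (r - s) := by rw [hc]; field_simp
  have h3 : ‖∫ t in s..r, v t‖ ^ 2 ≤ m ^ 2 := by gcongr
  nlinarith

lemma aux_key (w v : ℝ → ℂ) (hw : ∀ r ∈ Ioo (0:ℝ) 1, HasDerivAt w (v r) r)
    (hv : ContinuousOn v (Ioo (0:ℝ) 1)) (δ : ℝ) (h0 : 0 < δ) (h4 : δ ≤ 1 / 4) :
    (∫⁻ r in Ioo (0:ℝ) 1, ENNReal.ofReal (r * ‖w r‖ ^ 2)) ≤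
      ENNReal.ofReal (5 / δ) * (∫⁻ r in Ioo (0:ℝ) 1, ENNReal.ofReal ((1 - r ^ 2) * r * ‖w r‖ ^ 2))
      + ENNReal.ofReal (4 * δ ^ 2) * (∫⁻ r in Ioo (0:ℝ) 1, ENNReal.ofReal (‖v r‖ ^ 2 * r)) := by
  set A := ∫⁻ r in Ioo (0:ℝ) 1, ENNReal.ofReal ((1 - r ^ 2) * r * ‖w r‖ ^ 2) with hA
  set B := ∫⁻ r in Ioo (0:ℝ) 1, ENNReal.ofReal (‖v r‖ ^ 2 * r) with hB
  -- the part away from the boundary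
  have hin : (∫⁻ r in Ioc (0:ℝ) (1 - δ), ENNReal.ofReal (r * ‖w r‖ ^ 2)) ≤
      ENNReal.ofReal (1 / δ) * A := by
    rw [hA, ← lintegral_const_mul' _ _ ENNReal.ofReal_ne_top]
    calc _ ≤ ∫⁻ r in Ioc (0:ℝ) (1 - δ), ENNReal.ofReal (1 / δ) *
              ENNReal.ofReal ((1 - r ^ 2) * r * ‖w r‖ ^ 2) := by
          apply setLIntegral_mono' measurableSet_Ioc
          intro r hr
          rw [← ENNReal.ofReal_mul (by positivity)]
          apply ENNReal.ofReal_le_ofReal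
          have : 0 ≤ r * ‖w r‖ ^ 2 := mul_nonneg hr.1.le (by positivity)
          have h5 : δ ≤ 1 - r ^ 2 := by nlinarith [hr.1, hr.2]
          rw [div_mul_eq_mul_div, le_div_iff₀ h0]
          nlinarith
      _ ≤ _ := lintegral_mono_set
        (show Ioc (0:ℝ) (1 - δ) ⊆ Ioo 0 1 from fun r hr => ⟨hr.1, by linarith [hr.2]⟩)
  -- pointwise bound
  have hpt : ∀ r ∈ Ioo (1 - δ) 1, ENNReal.ofReal (r * ‖w r‖ ^ 2) ≤
      ENNReal.ofReal (4 * ((r - δ) * ‖w (r - δ)‖ ^ 2)) + ENNReal.ofReal (4 * δ) * B := by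
    intro r hr
    have hsub : Icc (r - δ) r ⊆ Ioo (0:ℝ) 1 := fun t ht =>
      ⟨by linarith [ht.1, hr.1], by linarith [ht.2, hr.2]⟩
    have hle : r - δ ≤ r := by linarith
    have hvc : ContinuousOn v (Icc (r - δ) r) := hv.mono hsub
    have hftc : ∫ t in (r - δ)..r, v t = w r - w (r - δ) := by
      apply intervalIntegral.integral_eq_sub_of_hasDerivAt
      · intro t ht
        rw [uIcc_of_le hle] at ht
        exact hw t (hsub ht)
      · apply ContinuousOn.intervalIntegrable
        rwa [uIcc_of_le hle]
    have hcs := aux_cs v (r - δ) r hle hvc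
    rw [hftc] at hcs
    have hIB : ENNReal.ofReal (∫ t in (r - δ)..r, ‖v t‖ ^ 2) ≤ ENNReal.ofReal 2 * B := by
      have hint : IntegrableOn (fun t => ‖v t‖ ^ 2) (Ioc (r - δ) r) volume :=
        ((hvc.norm.pow 2).integrableOn_Icc).mono_set Ioc_subset_Icc_self
      rw [intervalIntegral.integral_of_le hle, ofReal_integral_eq_lintegral_ofReal hint
        (Filter.Eventually.of_forall fun t => sq_nonneg _), hB,
        ← lintegral_const_mul' _ _ ENNReal.ofReal_ne_top]
      calc _ ≤ ∫⁻ t in Ioc (r - δ) r, ENNReal.ofReal 2 * ENNReal.ofReal (‖v t‖ ^ 2 * t) := by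
            apply setLIntegral_mono' measurableSet_Ioc
            intro t ht
            rw [← ENNReal.ofReal_mul (by positivity)]
            apply ENNReal.ofReal_le_ofReal
            have : 1 / 2 ≤ t := by linarith [ht.1, hr.1]
            nlinarith [sq_nonneg ‖v t‖]
        _ ≤ _ := lintegral_mono_set (Ioc_subset_Icc_self.trans hsub)
    have hI0 : 0 ≤ ∫ t in (r - δ)..r, ‖v t‖ ^ 2 :=
      intervalIntegral.integral_nonneg hle fun t _ => by positivity
    set J := ∫ t in (r - δ)..r, ‖v t‖ ^ 2 with hJ
    have hreal : r * ‖w r‖ ^ 2 ≤ 4 * ((r - δ) * ‖w (r - δ)‖ ^ 2) + 2 * δ * J := by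
      have n1 : ‖w r‖ ≤ ‖w (r - δ)‖ + ‖w r - w (r - δ)‖ := by
        have := norm_add_le (w (r - δ)) (w r - w (r - δ))
        simpa using this
      have n2 : ‖w r‖ ^ 2 ≤ 2 * ‖w (r - δ)‖ ^ 2 + 2 * ‖w r - w (r - δ)‖ ^ 2 := by
        have := pow_le_pow_left₀ (norm_nonneg _) n1 2
        nlinarith [sq_nonneg (‖w (r - δ)‖ - ‖w r - w (r - δ)‖)]
      have n3 : r * ‖w r‖ ^ 2 ≤ ‖w r‖ ^ 2 := by nlinarith [sq_nonneg ‖w r‖, hr.2]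
      have n4 : 1 / 2 ≤ r - δ := by linarith [hr.1]
      have n5 : 2 * ‖w (r - δ)‖ ^ 2 ≤ 4 * ((r - δ) * ‖w (r - δ)‖ ^ 2) := by
        nlinarith [sq_nonneg ‖w (r - δ)‖]
      have n6 : r - (r - δ) = δ := by ring
      rw [n6] at hcs
      linarith
    calc _ ≤ ENNReal.ofReal (4 * ((r - δ) * ‖w (r - δ)‖ ^ 2) + 2 * δ * J) :=
          ENNReal.ofReal_le_ofReal hreal
      _ ≤ ENNReal.ofReal (4 * ((r - δ) * ‖w (r - δ)‖ ^ 2)) + ENNReal.ofReal (2 * δ * J) :=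
          ENNReal.ofReal_add_le
      _ ≤ _ := by
        gcongr
        rw [ENNReal.ofReal_mul (by positivity)]
        calc _ ≤ ENNReal.ofReal (2 * δ) * (ENNReal.ofReal 2 * B) := by gcongr
          _ = _ := by
            rw [← mul_assoc, ← ENNReal.ofReal_mul (by positivity)]
            congr 2; ring
  have htr : (∫⁻ r in Ioo (1 - δ) 1, ENNReal.ofReal (4 * ((r - δ) * ‖w (r - δ)‖ ^ 2))) ≤
      ENNReal.ofReal 4 * ∫⁻ r in Ioc (0:ℝ) (1 - δ), ENNReal.ofReal (r * ‖w r‖ ^ 2) := by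
    rw [← lintegral_const_mul' _ _ ENNReal.ofReal_ne_top,
      ← lintegral_indicator measurableSet_Ioo, ← lintegral_indicator measurableSet_Ioc]
    rw [← lintegral_sub_right_eq_self ((Ioc (0:ℝ) (1 - δ)).indicator _) δ]
    apply lintegral_mono
    intro r
    by_cases hr : r ∈ Ioo (1 - δ) 1
    · have hr' : r - δ ∈ Ioc (0:ℝ) (1 - δ) := ⟨by linarith [hr.1], by linarith [hr.2]⟩
      simp only [indicator_of_mem hr, indicator_of_mem hr']
      rw [ENNReal.ofReal_mul (by norm_num)]
    · simp only [indicator_of_notMem hr]; exact zero_le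
  have hout : (∫⁻ r in Ioo (1 - δ) 1, ENNReal.ofReal (r * ‖w r‖ ^ 2)) ≤
      ENNReal.ofReal (4 / δ) * A + ENNReal.ofReal (4 * δ ^ 2) * B := by
    calc _ ≤ ∫⁻ r in Ioo (1 - δ) 1, (ENNReal.ofReal (4 * ((r - δ) * ‖w (r - δ)‖ ^ 2)) +
              ENNReal.ofReal (4 * δ) * B) := setLIntegral_mono' measurableSet_Ioo hpt
      _ = (∫⁻ r in Ioo (1 - δ) 1, ENNReal.ofReal (4 * ((r - δ) * ‖w (r - δ)‖ ^ 2))) +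
            ENNReal.ofReal (4 * δ) * B * ENNReal.ofReal δ := by
          rw [lintegral_add_right _ measurable_const, setLIntegral_const, Real.volume_Ioo]
          congr 3; ring
      _ ≤ ENNReal.ofReal 4 * (ENNReal.ofReal (1 / δ) * A) +
            ENNReal.ofReal (4 * δ) * B * ENNReal.ofReal δ := by
          gcongr
          exact htr.trans (by gcongr)
      _ = _ := by
          rw [← mul_assoc, ← ENNReal.ofReal_mul (by positivity), mul_right_comm,
            ← ENNReal.ofReal_mul (by positivity)]
          congr 3 <;> ring
  calc _ ≤ ∫⁻ r in Ioc (0:ℝ) (1 - δ) ∪ Ioo (1 - δ) 1, ENNReal.ofReal (r * ‖w r‖ ^ 2) := by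
        apply lintegral_mono_set
        intro r hr
        rcases le_or_gt r (1 - δ) with h | h
        · exact Or.inl ⟨hr.1, h⟩
        · exact Or.inr ⟨h, hr.2⟩
    _ ≤ _ := lintegral_union_le _ _ _
    _ ≤ ENNReal.ofReal (1 / δ) * A +
        (ENNReal.ofReal (4 / δ) * A + ENNReal.ofReal (4 * δ ^ 2) * B) := add_le_add hin hout
    _ = _ := by
      rw [← add_assoc, ← add_mul, ← ENNReal.ofReal_add (by positivity) (by positivity)]
      congr 3; ring

lemma aux_alg (P A B : ENNReal) (hA0 : A = 0 → P = 0)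
    (h : ∀ δ : ℝ, 0 < δ → δ ≤ 1 / 4 →
      P ≤ ENNReal.ofReal (5 / δ) * A + ENNReal.ofReal (4 * δ ^ 2) * B) :
    P ≤ ENNReal.ofReal 36 * A ^ ((2:ℝ)/3) * B ^ ((1:ℝ)/3) + ENNReal.ofReal 36 * A := by
  by_cases hz : A = 0
  · rw [hA0 hz]; exact zero_le
  by_cases hAt : A = ⊤
  · rw [hAt, ENNReal.mul_top (by simp)]; simp
  by_cases hBt : B = ⊤
  · rw [hBt, ENNReal.top_rpow_of_pos (by norm_num), ENNReal.mul_top]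
    · simp
    · apply mul_ne_zero (by simp)
      intro h'
      rw [ENNReal.rpow_eq_zero_iff] at h'
      rcases h' with h' | h'
      · exact hz h'.1
      · exact hAt h'.1
  lift A to NNReal using hAt
  lift B to NNReal using hBt
  have ha : 0 < (A:ℝ) := by
    have : A ≠ 0 := by simpa using hz
    positivity
  have hb : 0 ≤ (B:ℝ) := B.2
  have eA : (A : ENNReal) = ENNReal.ofReal (A:ℝ) := (ENNReal.ofReal_coe_nnreal).symm
  have eB : (B : ENNReal) = ENNReal.ofReal (B:ℝ) := (ENNReal.ofReal_coe_nnreal).symm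
  rw [eA] at hA0 h ⊢
  rw [eB] at h ⊢
  clear hz eA eB
  generalize (A:ℝ) = a at *
  generalize (B:ℝ) = b at *
  rcases le_or_gt b (64 * a) with hba | hba
  · refine (h (1/4) (by norm_num) le_rfl).trans ?_
    refine le_trans ?_ le_add_self
    rw [← ENNReal.ofReal_mul (by norm_num), ← ENNReal.ofReal_mul (by norm_num),
      ← ENNReal.ofReal_mul (by norm_num), ← ENNReal.ofReal_add (by positivity) (by positivity)]
    apply ENNReal.ofReal_le_ofReal
    linarith
  · have hb' : 0 < b := by linarith
    obtain ⟨x, hx, hxa⟩ : ∃ x : ℝ, 0 < x ∧ x ^ 3 = a := ⟨a ^ ((1:ℝ)/3), by positivity, by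
      rw [← Real.rpow_natCast, ← Real.rpow_mul ha.le]; norm_num⟩
    obtain ⟨y, hy, hyb⟩ : ∃ x : ℝ, 0 < x ∧ x ^ 3 = b := ⟨b ^ ((1:ℝ)/3), by positivity, by
      rw [← Real.rpow_natCast, ← Real.rpow_mul hb]; norm_num⟩
    have hxy : 4 * x < y := by
      apply lt_of_pow_lt_pow_left₀ 3 hy.le
      rw [mul_pow, hxa, hyb]; linarith
    refine (h (x / y) (by positivity) ?_).trans ?_
    · rw [div_le_iff₀ hy]; linarith
    refine le_trans ?_ le_self_add
    have e1 : a ^ ((2:ℝ)/3) = x ^ 2 := by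
      rw [← hxa, ← Real.rpow_natCast, ← Real.rpow_mul hx.le, ← Real.rpow_natCast]; norm_num
    have e2 : b ^ ((1:ℝ)/3) = y := by
      rw [← hyb, ← Real.rpow_natCast, ← Real.rpow_mul hy.le]; norm_num
    rw [ENNReal.ofReal_rpow_of_pos ha, ENNReal.ofReal_rpow_of_pos hb', e1, e2,
      ← ENNReal.ofReal_mul (by positivity), ← ENNReal.ofReal_mul (by positivity),
      ← ENNReal.ofReal_mul (by positivity), ← ENNReal.ofReal_mul (by positivity),
      ← ENNReal.ofReal_add (by positivity) (by positivity)]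
    apply ENNReal.ofReal_le_ofReal
    rw [← hxa, ← hyb]
    have : 5 / (x / y) * x ^ 3 + 4 * (x / y) ^ 2 * y ^ 3 = 9 * (x ^ 2 * y) := by
      field_simp; ring
    rw [this]
    nlinarith [mul_pos (pow_pos hx 2) hy]

/-- Weighted interpolation inequality: there is a universal `C > 0` such that
for every C² function `g` on `[0,1]`, with `L g = g'' + g'/r − g/r²`,
`∫₀¹ |(rg)'|²/r ≤ C (∫₀¹ ((1−r²)/r)|(rg)'|²)^{2/3} (∫₀¹ |Lg|² r)^{1/3}
  + C ∫₀¹ ((1−r²)/r)|(rg)'|²`. -/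
theorem stmt6 :
    ∃ C : ℝ, 0 < C ∧ ∀ g : ℝ → ℂ, ContDiffOn ℝ 2 g (Icc (0:ℝ) 1) →
      (∫⁻ r in Ioo (0:ℝ) 1,
          ENNReal.ofReal (‖derivWithin (fun s : ℝ => (s : ℂ) * g s) (Icc (0:ℝ) 1) r‖ ^ 2 / r)) ≤
        ENNReal.ofReal C *
            (∫⁻ r in Ioo (0:ℝ) 1,
                ENNReal.ofReal
                  (((1 - r ^ 2) / r) *
                    ‖derivWithin (fun s : ℝ => (s : ℂ) * g s) (Icc (0:ℝ) 1) r‖ ^ 2)) ^ ((2 : ℝ) / 3) *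
            (∫⁻ r in Ioo (0:ℝ) 1,
                ENNReal.ofReal
                  (‖derivWithin (derivWithin g (Icc (0:ℝ) 1)) (Icc (0:ℝ) 1) r
                      + derivWithin g (Icc (0:ℝ) 1) r / (r : ℂ)
                      - g r / (r : ℂ) ^ 2‖ ^ 2 * r)) ^ ((1 : ℝ) / 3)
          + ENNReal.ofReal C *
              ∫⁻ r in Ioo (0:ℝ) 1,
                ENNReal.ofReal
                  (((1 - r ^ 2) / r) *
                    ‖derivWithin (fun s : ℝ => (s : ℂ) * g s) (Icc (0:ℝ) 1) r‖ ^ 2) := by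
  refine ⟨36, by norm_num, ?_⟩
  intro g hg
  set I := Icc (0:ℝ) 1 with hI
  have hu : UniqueDiffOn ℝ I := uniqueDiffOn_Icc zero_lt_one
  set g1 := derivWithin g I with hg1
  set g2 := derivWithin g1 I with hg2
  have hc1 : ContDiffOn ℝ 1 g1 I := hg.derivWithin hu (by norm_num)
  have hc2 : ContinuousOn g2 I := hc1.continuousOn_derivWithin hu le_rfl
  have hmem : ∀ r ∈ Ioo (0:ℝ) 1, I ∈ nhds r := fun r hr => Icc_mem_nhds hr.1 hr.2
  have hd1 : ∀ r ∈ Ioo (0:ℝ) 1, HasDerivAt g (g1 r) r := fun r hr =>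
    ((hg.differentiableOn (by norm_num)) r (Ioo_subset_Icc_self hr)).hasDerivWithinAt.hasDerivAt
      (hmem r hr)
  have hd2 : ∀ r ∈ Ioo (0:ℝ) 1, HasDerivAt g1 (g2 r) r := fun r hr =>
    ((hc1.differentiableOn (by norm_num)) r (Ioo_subset_Icc_self hr)).hasDerivWithinAt.hasDerivAt
      (hmem r hr)
  have hne : ∀ r ∈ Ioo (0:ℝ) 1, (r:ℂ) ≠ 0 := fun r hr => by exact_mod_cast hr.1.ne'
  have hofr : ∀ r : ℝ, HasDerivAt (fun s : ℝ => (s:ℂ)) 1 r := fun r => Complex.ofRealCLM.hasDerivAt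
  let w : ℝ → ℂ := fun r => g1 r + g r / (r:ℂ)
  let v : ℝ → ℂ := fun r => g2 r + g1 r / (r:ℂ) - g r / (r:ℂ) ^ 2
  have hh : ∀ r ∈ Ioo (0:ℝ) 1, derivWithin (fun s : ℝ => (s : ℂ) * g s) I r = r * w r := by
    intro r hr
    have hm : HasDerivAt (fun s : ℝ => (s : ℂ) * g s) (1 * g r + r * g1 r) r :=
      (hofr r).mul (hd1 r hr)
    rw [derivWithin_of_mem_nhds (hmem r hr), hm.deriv]
    have := hne r hr
    simp only [w]
    field_simp
    ring
  have hw : ∀ r ∈ Ioo (0:ℝ) 1, HasDerivAt w (v r) r := by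
    intro r hr
    have := hne r hr
    refine HasDerivAt.congr_deriv (f := w) ((hd2 r hr).add ((hd1 r hr).div (hofr r) this)) ?_
    simp only [v]
    field_simp
    ring
  have hv : ContinuousOn v (Ioo (0:ℝ) 1) := by
    have i1 : ContinuousOn g (Ioo (0:ℝ) 1) := hg.continuousOn.mono Ioo_subset_Icc_self
    have i2 : ContinuousOn g1 (Ioo (0:ℝ) 1) := hc1.continuousOn.mono Ioo_subset_Icc_self
    have i3 : ContinuousOn g2 (Ioo (0:ℝ) 1) := hc2.mono Ioo_subset_Icc_self
    have i4 : ContinuousOn (fun s : ℝ => (s:ℂ)) (Ioo (0:ℝ) 1) :=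
      Complex.continuous_ofReal.continuousOn
    exact (i3.add (i2.div i4 hne)).sub (i1.div (i4.pow 2) fun r hr => pow_ne_zero 2 (hne r hr))
  have hn : ∀ r ∈ Ioo (0:ℝ) 1, ‖(r:ℂ) * w r‖ ^ 2 = r ^ 2 * ‖w r‖ ^ 2 := by
    intro r hr
    rw [norm_mul, mul_pow, Complex.norm_real, Real.norm_eq_abs, sq_abs]
  have eP : (∫⁻ r in Ioo (0:ℝ) 1,
      ENNReal.ofReal (‖derivWithin (fun s : ℝ => (s : ℂ) * g s) I r‖ ^ 2 / r)) =
      ∫⁻ r in Ioo (0:ℝ) 1, ENNReal.ofReal (r * ‖w r‖ ^ 2) := by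
    apply setLIntegral_congr_fun measurableSet_Ioo
    intro r hr
    have := hr.1.ne'
    simp only
    rw [hh r hr, hn r hr]
    congr 1
    field_simp
  have eA : (∫⁻ r in Ioo (0:ℝ) 1,
      ENNReal.ofReal (((1 - r ^ 2) / r) *
        ‖derivWithin (fun s : ℝ => (s : ℂ) * g s) I r‖ ^ 2)) =
      ∫⁻ r in Ioo (0:ℝ) 1, ENNReal.ofReal ((1 - r ^ 2) * r * ‖w r‖ ^ 2) := by
    apply setLIntegral_congr_fun measurableSet_Ioo
    intro r hr
    have := hr.1.ne'
    simp only
    rw [hh r hr, hn r hr]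
    congr 1
    field_simp
  rw [eP, eA]
  apply aux_alg
  · intro h0
    have hwc : ContinuousOn w (Ioo (0:ℝ) 1) := fun r hr => (hw r hr).continuousAt.continuousWithinAt
    have hmeas : AEMeasurable (fun r : ℝ => ENNReal.ofReal ((1 - r ^ 2) * r * ‖w r‖ ^ 2))
        (volume.restrict (Ioo (0:ℝ) 1)) := by
      apply AEMeasurable.ennreal_ofReal
      apply ContinuousOn.aemeasurable _ measurableSet_Ioo
      exact (Continuous.continuousOn (by fun_prop)).mul (hwc.norm.pow 2)
    rw [lintegral_eq_zero_iff' hmeas] at h0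
    apply lintegral_eq_zero_of_ae_eq_zero
    filter_upwards [h0, ae_restrict_mem measurableSet_Ioo] with r h1 hr
    simp only [Pi.zero_apply, ENNReal.ofReal_eq_zero] at h1 ⊢
    have h2 : 0 < 1 - r ^ 2 := by nlinarith [hr.1, hr.2]
    by_contra! h3
    nlinarith [mul_pos h2 h3]
  · intro δ h0 h4
    exact aux_key w v hw hv δ h0 h4
end
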